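/- Let F be a field of characteristic 0. In F[x₁,x₂], the radical of the ideal generated by the three polynomials x₂(x₂−x₁), x₁²(x₁−1), x₂x₁(x₁−1) equals the ideal generated by the three polynomials x₁(x₁−1), x₂(x₁−1), x₂(x₂−1); moreover the common zero set of the latter ideal in F² is exactly the three-element set {(0,0), (1,0), (1,1)}. -/

import Mathlib

open MvPolynomial

/-- Modulo the ideal `(x₁(x₁−1), x₂(x₁−1), x₂(x₂−1))`, a polynomial is congruent to its Lagrange
interpolation at the points `(0,0), (1,0), (1,1)`. -/
theorem sub_lagrange_mem_span {R : Type*} [CommRing R] (f : MvPolynomial (Fin 2) R) :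
    f - (C (eval ![0, 0] f) * (1 - X 0) + C (eval ![1, 0] f) * (X 0 - X 1) +
      C (eval ![1, 1] f) * X 1) ∈
      (Ideal.span {X 0 * (X 0 - 1), X 1 * (X 0 - 1), X 1 * (X 1 - 1)} :
        Ideal (MvPolynomial (Fin 2) R)) := by
  induction f using MvPolynomial.induction_on with
  | C a =>
    convert Ideal.zero_mem _ using 1
    simp only [eval_C]
    ring
  | add p q hp hq =>
    convert Ideal.add_mem _ hp hq using 1
    simp only [map_add]
    ring
  | mul_X p i hp =>
    obtain ⟨a, b, c, h⟩ := Submodule.mem_span_triple.mp hp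
    refine Submodule.mem_span_triple.mpr ?_
    simp only [smul_eq_mul] at h ⊢
    fin_cases i
    · refine ⟨a * X 0 - C (eval ![0, 0] p) + C (eval ![1, 0] p),
        b * X 0 - C (eval ![1, 0] p) + C (eval ![1, 1] p), c * X 0, ?_⟩
      simp
      linear_combination X 0 * h
    · refine ⟨a * X 1, b * X 1 - C (eval ![0, 0] p) + C (eval ![1, 0] p),
        c * X 1 - C (eval ![1, 0] p) + C (eval ![1, 1] p), ?_⟩
      simp
      linear_combination X 1 * h

theorem mem_span_of_eval_eq_zero {R : Type*} [CommRing R] {f : MvPolynomial (Fin 2) R}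
    (h00 : eval ![0, 0] f = 0) (h10 : eval ![1, 0] f = 0) (h11 : eval ![1, 1] f = 0) :
    f ∈ (Ideal.span {X 0 * (X 0 - 1), X 1 * (X 0 - 1), X 1 * (X 1 - 1)} :
      Ideal (MvPolynomial (Fin 2) R)) := by
  simpa [h00, h10, h11] using sub_lagrange_mem_span f

theorem forall_mem_span_eval_eq_zero_iff {R : Type*} [CommRing R] [IsDomain R] (x : Fin 2 → R) :
    (∀ f ∈ (Ideal.span {X 0 * (X 0 - 1), X 1 * (X 0 - 1), X 1 * (X 1 - 1)} :
      Ideal (MvPolynomial (Fin 2) R)), eval x f = 0) ↔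
      (x = ![0, 0] ∨ x = ![1, 0] ∨ x = ![1, 1]) := by
  constructor
  · intro h
    have h₁ := h _ (Ideal.subset_span (Set.mem_insert _ _))
    have h₂ := h _ (Ideal.subset_span (Set.mem_insert_of_mem _ (Set.mem_insert _ _)))
    have h₃ := h _ (Ideal.subset_span (Set.mem_insert_of_mem _ (Set.mem_insert_of_mem _ rfl)))
    simp only [map_mul, map_sub, map_one, eval_X, mul_eq_zero, sub_eq_zero] at h₁ h₂ h₃
    simp only [funext_iff, Fin.forall_fin_two, Matrix.cons_val_zero, Matrix.cons_val_one]
    grind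
  · intro hx f hf
    obtain ⟨a, b, c, rfl⟩ := Submodule.mem_span_triple.mp hf
    rcases hx with rfl | rfl | rfl <;> simp

theorem isRadical_span_three_points {R : Type*} [CommRing R] [IsDomain R] :
    (Ideal.span {X 0 * (X 0 - 1), X 1 * (X 0 - 1), X 1 * (X 1 - 1)} :
      Ideal (MvPolynomial (Fin 2) R)).IsRadical := by
  rintro f ⟨n, hn⟩
  have hf (x : Fin 2 → R) (hx : x = ![0, 0] ∨ x = ![1, 0] ∨ x = ![1, 1]) : eval x f = 0 := by
    have := (forall_mem_span_eval_eq_zero_iff x).mpr hx _ hn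
    rw [map_pow] at this
    exact eq_zero_of_pow_eq_zero this
  exact mem_span_of_eval_eq_zero (hf _ (by simp)) (hf _ (by simp)) (hf _ (by simp))

/-- In `F[x₁,x₂]` (variables `X 0, X 1` correspond to `x₁, x₂`), the radical of the ideal
generated by `x₂(x₂−x₁), x₁²(x₁−1), x₂x₁(x₁−1)` equals the ideal generated by
`x₁(x₁−1), x₂(x₁−1), x₂(x₂−1)`; moreover the common zero set of the latter ideal in `F²`
is exactly `{(0,0), (1,0), (1,1)}`. -/
theorem radical_and_zeroSet_x1x2 (F : Type*) [Field F] [CharZero F] :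
    ((Ideal.span {X 1 * (X 1 - X 0), (X 0) ^ 2 * (X 0 - 1), X 1 * X 0 * (X 0 - 1)} :
      Ideal (MvPolynomial (Fin 2) F)).radical =
      Ideal.span {X 0 * (X 0 - 1), X 1 * (X 0 - 1), X 1 * (X 1 - 1)}) ∧
    (∀ x : Fin 2 → F,
      (∀ f ∈ (Ideal.span {X 0 * (X 0 - 1), X 1 * (X 0 - 1), X 1 * (X 1 - 1)} :
        Ideal (MvPolynomial (Fin 2) F)), MvPolynomial.eval x f = 0) ↔
      (x = ![0, 0] ∨ x = ![1, 0] ∨ x = ![1, 1])) := by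
  refine ⟨le_antisymm (isRadical_span_three_points.radical_le_iff.mpr ?_) ?_,
    forall_mem_span_eval_eq_zero_iff⟩
  · rw [Ideal.span_le]
    rintro f (rfl | rfl | rfl) <;> refine Submodule.mem_span_triple.mpr ?_ <;>
      simp only [smul_eq_mul]
    · exact ⟨0, -1, 1, by ring⟩
    · exact ⟨X 0, 0, 0, by ring⟩
    · exact ⟨0, X 0, 0, by ring⟩
  · rw [Ideal.span_le]
    rintro f (rfl | rfl | rfl) <;> refine ⟨2, Submodule.mem_span_triple.mpr ?_⟩ <;>
      simp only [smul_eq_mul]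
    · exact ⟨0, X 0 - 1, 0, by ring⟩
    · exact ⟨(X 0 - 1) ^ 2, 0, X 0 - 1, by ring⟩
    · exact ⟨(X 1 - 1) ^ 2 + X 0 * (X 0 + X 1 - 2), 0, X 0 - 1, by ring⟩
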